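/- Let d ≥ 1, let P be a compactly supported probability measure on ℝ^d, let σ > 0, and let g : ℝ^d → ℝ^d be bounded and measurable. Then the direct score-matching objective and the denoising score-matching objective differ by a constant independent of g; explicitly, ∫ ½‖g(y) − ∇log Q_σ(y)‖² Q_σ(y) dy − ∫ (∫ ½‖g(y) − (x − y)/σ²‖² q_σ(y,x) dy) dP(x) = ∫ ½‖∇log Q_σ(y)‖² Q_σ(y) dy − ∫ (∫ ½‖(x − y)/σ²‖² q_σ(y,x) dy) dP(x), where both sides are finite. -/

import Mathlib

open MeasureTheory Real Filter Topology
open scoped InnerProductSpace ENNReal BigOperators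

/-- The Gaussian kernel `q_σ(y, x) = (2πσ²)^{-d/2} exp(−‖y − x‖²/(2σ²))` on `ℝ^d`. -/
noncomputable def gaussKernel (d : ℕ) (σ : ℝ) (y x : EuclideanSpace ℝ (Fin d)) : ℝ :=
  (2 * π * σ ^ 2) ^ (-(d : ℝ) / 2) * Real.exp (-‖y - x‖ ^ 2 / (2 * σ ^ 2))

/-- The smoothed density `Q_σ(y) = ∫ q_σ(y, x) dP(x)`. -/
noncomputable def smoothedDensity (d : ℕ) (σ : ℝ)
    (P : Measure (EuclideanSpace ℝ (Fin d))) (y : EuclideanSpace ℝ (Fin d)) : ℝ :=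
  ∫ x, gaussKernel d σ y x ∂P

/-- The score `∇ log Q_σ` of the smoothed density. -/
noncomputable def score (d : ℕ) (σ : ℝ) (P : Measure (EuclideanSpace ℝ (Fin d)))
    (y : EuclideanSpace ℝ (Fin d)) : EuclideanSpace ℝ (Fin d) :=
  gradient (fun z => Real.log (smoothedDensity d σ P z)) y

lemma gaussKernel_pos (d : ℕ) {σ : ℝ} (hσ : 0 < σ) (y x : EuclideanSpace ℝ (Fin d)) :
    0 < gaussKernel d σ y x := by
  unfold gaussKernel
  positivity

lemma continuous_gaussKernel (d : ℕ) (σ : ℝ) :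
    Continuous fun p : EuclideanSpace ℝ (Fin d) × EuclideanSpace ℝ (Fin d) =>
      gaussKernel d σ p.1 p.2 := by
  unfold gaussKernel
  fun_prop

lemma gaussKernel_le (d : ℕ) {σ : ℝ} (hσ : 0 < σ) (y x : EuclideanSpace ℝ (Fin d)) :
    gaussKernel d σ y x ≤ (2 * π * σ ^ 2) ^ (-(d : ℝ) / 2) := by
  unfold gaussKernel
  refine mul_le_of_le_one_right (by positivity) (Real.exp_le_one_iff.2 ?_)
  rw [neg_div]
  exact neg_nonpos.2 (by positivity)

lemma norm_sq_inv_smul_sub {d : ℕ} {σ : ℝ} (hσ : 0 < σ) (y x : EuclideanSpace ℝ (Fin d)) :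
    ‖(σ ^ 2)⁻¹ • (x - y)‖ ^ 2 = 2 / σ ^ 2 * (‖y - x‖ ^ 2 / (2 * σ ^ 2)) := by
  rw [norm_smul, norm_sub_rev, Real.norm_of_nonneg (by positivity)]
  field_simp

lemma norm_sq_mul_gaussKernel_le (d : ℕ) {σ : ℝ} (hσ : 0 < σ)
    (y x : EuclideanSpace ℝ (Fin d)) :
    ‖(σ ^ 2)⁻¹ • (x - y)‖ ^ 2 * gaussKernel d σ y x ≤
      2 / σ ^ 2 * (2 * π * σ ^ 2) ^ (-(d : ℝ) / 2) := by
  rw [norm_sq_inv_smul_sub hσ]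
  unfold gaussKernel
  rw [neg_div (2 * σ ^ 2)]
  set t := ‖y - x‖ ^ 2 / (2 * σ ^ 2)
  have h : t * Real.exp (-t) ≤ 1 := by
    rw [Real.exp_neg, ← div_eq_mul_inv, div_le_one (Real.exp_pos t)]
    linarith [Real.add_one_le_exp t]
  have hc : 0 ≤ 2 / σ ^ 2 * (2 * π * σ ^ 2) ^ (-(d : ℝ) / 2) := by positivity
  nlinarith [mul_le_mul_of_nonneg_left h hc]

lemma norm_mul_gaussKernel_le (d : ℕ) {σ : ℝ} (hσ : 0 < σ) (y x : EuclideanSpace ℝ (Fin d)) :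
    ‖gaussKernel d σ y x • (σ ^ 2)⁻¹ • (x - y)‖ ≤
      (1 + 2 / σ ^ 2) * (2 * π * σ ^ 2) ^ (-(d : ℝ) / 2) := by
  have hq := gaussKernel_pos d hσ y x
  rw [norm_smul, Real.norm_of_nonneg hq.le]
  have h1 := gaussKernel_le d hσ y x
  have h2 := norm_sq_mul_gaussKernel_le d hσ y x
  nlinarith [mul_nonneg hq.le (sq_nonneg (‖(σ ^ 2)⁻¹ • (x - y)‖ - 1)),
    mul_nonneg hq.le (sq_nonneg (‖(σ ^ 2)⁻¹ • (x - y)‖))]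

section Integrability

variable {d : ℕ} {σ : ℝ} {P : Measure (EuclideanSpace ℝ (Fin d))} [IsProbabilityMeasure P]

lemma integrable_gaussKernel_right (hσ : 0 < σ) (y : EuclideanSpace ℝ (Fin d)) :
    Integrable (fun x => gaussKernel d σ y x) P := by
  refine Integrable.of_bound ?_ ((2 * π * σ ^ 2) ^ (-(d : ℝ) / 2)) (.of_forall fun x => ?_)
  · exact ((continuous_gaussKernel d σ).comp (by fun_prop : Continuous fun x => (y, x)))
      |>.aestronglyMeasurable
  · rw [Real.norm_of_nonneg (gaussKernel_pos d hσ y x).le]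
    exact gaussKernel_le d hσ y x

lemma continuous_gaussKernel_smul (d : ℕ) (σ : ℝ) :
    Continuous fun p : EuclideanSpace ℝ (Fin d) × EuclideanSpace ℝ (Fin d) =>
      gaussKernel d σ p.1 p.2 • (σ ^ 2)⁻¹ • (p.2 - p.1) :=
  (continuous_gaussKernel d σ).smul (by fun_prop)

lemma continuous_norm_sq_mul_gaussKernel (d : ℕ) (σ : ℝ) :
    Continuous fun p : EuclideanSpace ℝ (Fin d) × EuclideanSpace ℝ (Fin d) =>
      ‖(σ ^ 2)⁻¹ • (p.2 - p.1)‖ ^ 2 * gaussKernel d σ p.1 p.2 :=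
  Continuous.mul (by fun_prop) (continuous_gaussKernel d σ)

lemma integrable_gaussKernel_smul_right (hσ : 0 < σ) (y : EuclideanSpace ℝ (Fin d)) :
    Integrable (fun x => gaussKernel d σ y x • (σ ^ 2)⁻¹ • (x - y)) P := by
  refine Integrable.of_bound ?_ _ (.of_forall fun x => norm_mul_gaussKernel_le d hσ y x)
  exact ((continuous_gaussKernel_smul d σ).comp (by fun_prop : Continuous fun x => (y, x)))
    |>.aestronglyMeasurable

lemma integrable_norm_sq_mul_gaussKernel_right (hσ : 0 < σ) (y : EuclideanSpace ℝ (Fin d)) :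
    Integrable (fun x => ‖(σ ^ 2)⁻¹ • (x - y)‖ ^ 2 * gaussKernel d σ y x) P := by
  refine Integrable.of_bound ?_ (2 / σ ^ 2 * (2 * π * σ ^ 2) ^ (-(d : ℝ) / 2))
    (.of_forall fun x => ?_)
  · exact ((continuous_norm_sq_mul_gaussKernel d σ).comp
      (by fun_prop : Continuous fun x => (y, x))).aestronglyMeasurable
  · rw [Real.norm_of_nonneg (mul_nonneg (sq_nonneg _) (gaussKernel_pos d hσ y x).le)]
    exact norm_sq_mul_gaussKernel_le d hσ y x

lemma smoothedDensity_pos (hσ : 0 < σ) (y : EuclideanSpace ℝ (Fin d)) :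
    0 < smoothedDensity d σ P y := by
  unfold smoothedDensity
  rw [integral_pos_iff_support_of_nonneg (fun x => (gaussKernel_pos d hσ y x).le)
    (integrable_gaussKernel_right hσ y)]
  have : Function.support (fun x => gaussKernel d σ y x) = Set.univ :=
    Set.eq_univ_of_forall fun x => (gaussKernel_pos d hσ y x).ne'
  simp [this]

lemma integrable_exp_neg_mul_norm_sq (d : ℕ) {b : ℝ} (hb : 0 < b) :
    Integrable fun v : EuclideanSpace ℝ (Fin d) => Real.exp (-b * ‖v‖ ^ 2) := by
  have h := (GaussianFourier.integrable_cexp_neg_mul_sq_norm_add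
    (V := EuclideanSpace ℝ (Fin d)) (b := (b : ℂ)) (by simpa using hb) 0 0).norm
  refine h.congr (.of_forall fun v => ?_)
  simp only [zero_mul, add_zero, Complex.norm_exp]
  congr 1
  norm_cast

/-- A function of the difference `y - x` that is Lebesgue integrable is integrable against
the product of Lebesgue measure and a probability measure. -/
lemma integrable_prod_comp_sub {f : EuclideanSpace ℝ (Fin d) → ℝ} (hc : Continuous f)
    (hf : Integrable f) :
    Integrable (fun p : EuclideanSpace ℝ (Fin d) × EuclideanSpace ℝ (Fin d) => f (p.1 - p.2))
      (volume.prod P) := by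
  rw [integrable_prod_iff' (by
    exact (hc.comp (continuous_fst.sub continuous_snd)).aestronglyMeasurable)]
  refine ⟨.of_forall fun x => hf.comp_sub_right x, ?_⟩
  have h (x : EuclideanSpace ℝ (Fin d)) : ∫ y, ‖f (y - x)‖ = ∫ y, ‖f y‖ :=
    integral_sub_right_eq_self (fun y => ‖f y‖) x
  simp only [h]
  exact integrable_const _

lemma integrable_gaussKernel_prod (hσ : 0 < σ) :
    Integrable (fun p : EuclideanSpace ℝ (Fin d) × EuclideanSpace ℝ (Fin d) =>
      gaussKernel d σ p.1 p.2) (volume.prod P) := by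
  have h := (integrable_exp_neg_mul_norm_sq d (b := (2 * σ ^ 2)⁻¹) (by positivity)).const_mul
    ((2 * π * σ ^ 2) ^ (-(d : ℝ) / 2))
  refine (integrable_prod_comp_sub (P := P) (by fun_prop) h).congr (.of_forall fun p => ?_)
  simp only [gaussKernel]
  congr 2
  ring

lemma integrable_norm_sq_mul_gaussKernel_prod (hσ : 0 < σ) :
    Integrable (fun p : EuclideanSpace ℝ (Fin d) × EuclideanSpace ℝ (Fin d) =>
      ‖(σ ^ 2)⁻¹ • (p.2 - p.1)‖ ^ 2 * gaussKernel d σ p.1 p.2) (volume.prod P) := by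
  have h := (integrable_exp_neg_mul_norm_sq d (b := (4 * σ ^ 2)⁻¹) (by positivity)).const_mul
    (4 / σ ^ 2 * (2 * π * σ ^ 2) ^ (-(d : ℝ) / 2))
  refine (integrable_prod_comp_sub (P := P) (by fun_prop) h).mono'
    (continuous_norm_sq_mul_gaussKernel d σ).aestronglyMeasurable (.of_forall fun p => ?_)
  rw [Real.norm_of_nonneg (mul_nonneg (sq_nonneg _) (gaussKernel_pos d hσ _ _).le),
    norm_sq_inv_smul_sub hσ]
  unfold gaussKernel
  rw [neg_div (2 * σ ^ 2), show -(4 * σ ^ 2)⁻¹ * ‖p.1 - p.2‖ ^ 2 =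
    -(‖p.1 - p.2‖ ^ 2 / (2 * σ ^ 2) / 2) by field_simp; ring]
  set t := ‖p.1 - p.2‖ ^ 2 / (2 * σ ^ 2)
  have h : t * Real.exp (-t) ≤ 2 * Real.exp (-(t / 2)) := by
    have h1 : t ≤ 2 * Real.exp (t / 2) := by linarith [Real.add_one_le_exp (t / 2)]
    calc t * Real.exp (-t) ≤ 2 * Real.exp (t / 2) * Real.exp (-t) := by gcongr
      _ = 2 * Real.exp (-(t / 2)) := by rw [mul_assoc, ← Real.exp_add]; ring_nf
  have hc : 0 ≤ 2 / σ ^ 2 * (2 * π * σ ^ 2) ^ (-(d : ℝ) / 2) := by positivity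
  linear_combination mul_le_mul_of_nonneg_left h hc

lemma integrable_norm_sub_sq_mul_gaussKernel_prod (hσ : 0 < σ)
    {g : EuclideanSpace ℝ (Fin d) → EuclideanSpace ℝ (Fin d)} (hg : Measurable g) {C : ℝ}
    (hC : ∀ y, ‖g y‖ ≤ C) :
    Integrable (fun p : EuclideanSpace ℝ (Fin d) × EuclideanSpace ℝ (Fin d) =>
      (1 / 2 : ℝ) * ‖g p.1 - (σ ^ 2)⁻¹ • (p.2 - p.1)‖ ^ 2 * gaussKernel d σ p.1 p.2)
      (volume.prod P) := by
  refine (((integrable_gaussKernel_prod hσ).const_mul (C ^ 2)).add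
    (integrable_norm_sq_mul_gaussKernel_prod hσ)).mono' ?_ (.of_forall fun p => ?_)
  · have := (continuous_gaussKernel d σ).measurable
    exact Measurable.aestronglyMeasurable (by fun_prop)
  · have hq := gaussKernel_pos d hσ p.1 p.2
    rw [Real.norm_of_nonneg (by positivity)]
    simp only [Pi.add_apply]
    rw [← add_mul]
    refine mul_le_mul_of_nonneg_right ?_ hq.le
    have h1 := norm_sub_le (g p.1) ((σ ^ 2)⁻¹ • (p.2 - p.1))
    have h2 := pow_le_pow_left₀ (norm_nonneg _) h1 2
    have h3 := pow_le_pow_left₀ (norm_nonneg _) (hC p.1) 2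
    nlinarith [sq_nonneg (‖g p.1‖ - ‖(σ ^ 2)⁻¹ • (p.2 - p.1)‖)]

end Integrability

section Score

variable {d : ℕ} {σ : ℝ} {P : Measure (EuclideanSpace ℝ (Fin d))} [IsProbabilityMeasure P]

lemma hasFDerivAt_gaussKernel (hσ : 0 < σ) (y x : EuclideanSpace ℝ (Fin d)) :
    HasFDerivAt (fun z => gaussKernel d σ z x)
      (innerSL ℝ (gaussKernel d σ y x • (σ ^ 2)⁻¹ • (x - y))) y := by
  have h1 : HasFDerivAt (fun z : EuclideanSpace ℝ (Fin d) => ‖z - x‖ ^ 2)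
      (2 • innerSL ℝ (y - x)) y := by
    simpa using ((hasFDerivAt_id y).sub_const x).norm_sq
  have h2 := (((h1.const_mul (-(2 * σ ^ 2)⁻¹)).exp).const_mul
    ((2 * π * σ ^ 2) ^ (-(d : ℝ) / 2)))
  have hk (z : EuclideanSpace ℝ (Fin d)) : gaussKernel d σ z x =
      (2 * π * σ ^ 2) ^ (-(d : ℝ) / 2) * Real.exp (-(2 * σ ^ 2)⁻¹ * ‖z - x‖ ^ 2) := by
    unfold gaussKernel
    congr 2
    ring
  simp only [hk]
  refine h2.congr_fderiv ?_
  ext w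
  simp
  field_simp
  ring

lemma hasGradientAt_smoothedDensity (hσ : 0 < σ) (y : EuclideanSpace ℝ (Fin d)) :
    HasGradientAt (smoothedDensity d σ P)
      (∫ x, gaussKernel d σ y x • (σ ^ 2)⁻¹ • (x - y) ∂P) y := by
  have hv := integrable_gaussKernel_smul_right (P := P) hσ y
  have h := hasFDerivAt_integral_of_dominated_of_fderiv_le (𝕜 := ℝ) (μ := P) (s := Set.univ)
    (F := fun z x => gaussKernel d σ z x)
    (F' := fun z x => innerSL ℝ (gaussKernel d σ z x • (σ ^ 2)⁻¹ • (x - z))) (x₀ := y)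
    (bound := fun _ => (1 + 2 / σ ^ 2) * (2 * π * σ ^ 2) ^ (-(d : ℝ) / 2)) Filter.univ_mem
    (.of_forall fun z => (integrable_gaussKernel_right hσ z).aestronglyMeasurable)
    (integrable_gaussKernel_right hσ y)
    ((innerSL ℝ).continuous.comp_aestronglyMeasurable hv.aestronglyMeasurable)
    (.of_forall fun x z _ => by
      rw [innerSL_apply_norm]
      exact norm_mul_gaussKernel_le d hσ z x)
    (integrable_const _)
    (.of_forall fun x z _ => hasFDerivAt_gaussKernel hσ z x)
  rw [hasGradientAt_iff_hasFDerivAt]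
  refine h.congr_fderiv ?_
  exact ContinuousLinearMap.integral_comp_comm (innerSL ℝ) hv

lemma score_eq (hσ : 0 < σ) (y : EuclideanSpace ℝ (Fin d)) :
    score d σ P y = (smoothedDensity d σ P y)⁻¹ •
      ∫ x, gaussKernel d σ y x • (σ ^ 2)⁻¹ • (x - y) ∂P := by
  refine HasGradientAt.gradient ?_
  have h := (hasGradientAt_smoothedDensity (P := P) hσ y).hasFDerivAt.log
    (smoothedDensity_pos hσ y).ne'
  rw [hasGradientAt_iff_hasFDerivAt]
  simpa using h

lemma measurable_smoothedDensity : Measurable (smoothedDensity d σ P) :=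
  ((continuous_gaussKernel d σ).stronglyMeasurable.integral_prod_right (ν := P)).measurable

lemma measurable_score (hσ : 0 < σ) : Measurable (score d σ P) := by
  rw [funext (score_eq (P := P) hσ)]
  exact measurable_smoothedDensity.inv.smul
    ((continuous_gaussKernel_smul d σ).stronglyMeasurable.integral_prod_right (ν := P)).measurable

/-- For a fixed point `y`, the pointwise direct and denoising losses of predicting `a`
differ by a quantity that does not depend on `a`. -/
lemma integral_norm_sub_sq_sub_norm_sq (hσ : 0 < σ) (y a : EuclideanSpace ℝ (Fin d)) :
    ∫ x, ((1 / 2 : ℝ) * ‖a - (σ ^ 2)⁻¹ • (x - y)‖ ^ 2 * gaussKernel d σ y x -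
        (1 / 2 : ℝ) * ‖(σ ^ 2)⁻¹ • (x - y)‖ ^ 2 * gaussKernel d σ y x) ∂P =
      (1 / 2 : ℝ) * ‖a - score d σ P y‖ ^ 2 * smoothedDensity d σ P y -
        (1 / 2 : ℝ) * ‖score d σ P y‖ ^ 2 * smoothedDensity d σ P y := by
  have hv := integrable_gaussKernel_smul_right (P := P) hσ y
  have hQ := (smoothedDensity_pos (P := P) hσ y).ne'
  have hm : ∫ x, gaussKernel d σ y x • (σ ^ 2)⁻¹ • (x - y) ∂P =
      smoothedDensity d σ P y • score d σ P y := by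
    rw [score_eq hσ, smul_inv_smul₀ hQ]
  have hpt (x : EuclideanSpace ℝ (Fin d)) :
      (1 / 2 : ℝ) * ‖a - (σ ^ 2)⁻¹ • (x - y)‖ ^ 2 * gaussKernel d σ y x -
        (1 / 2 : ℝ) * ‖(σ ^ 2)⁻¹ • (x - y)‖ ^ 2 * gaussKernel d σ y x =
      (1 / 2 : ℝ) * ‖a‖ ^ 2 * gaussKernel d σ y x -
        inner ℝ a (gaussKernel d σ y x • (σ ^ 2)⁻¹ • (x - y)) := by
    rw [norm_sub_sq_real, real_inner_smul_right _ _ (gaussKernel d σ y x)]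
    ring
  simp only [hpt]
  rw [integral_sub ((integrable_gaussKernel_right hσ y).const_mul _) (hv.const_inner a),
    integral_const_mul, integral_inner hv, hm, norm_sub_sq_real, real_inner_smul_right]
  change _ * smoothedDensity d σ P y - _ = _
  ring

lemma norm_score_sq_mul_smoothedDensity_le (hσ : 0 < σ) (y : EuclideanSpace ℝ (Fin d)) :
    ‖score d σ P y‖ ^ 2 * smoothedDensity d σ P y ≤
      ∫ x, ‖(σ ^ 2)⁻¹ • (x - y)‖ ^ 2 * gaussKernel d σ y x ∂P := by
  have h := integral_norm_sub_sq_sub_norm_sq (P := P) hσ y (score d σ P y)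
  have hle : -∫ x, ((1 / 2 : ℝ) * ‖score d σ P y - (σ ^ 2)⁻¹ • (x - y)‖ ^ 2 *
        gaussKernel d σ y x - (1 / 2 : ℝ) * ‖(σ ^ 2)⁻¹ • (x - y)‖ ^ 2 * gaussKernel d σ y x) ∂P ≤
      (1 / 2 : ℝ) * ∫ x, ‖(σ ^ 2)⁻¹ • (x - y)‖ ^ 2 * gaussKernel d σ y x ∂P := by
    by_cases hi : Integrable (fun x => (1 / 2 : ℝ) * ‖score d σ P y - (σ ^ 2)⁻¹ • (x - y)‖ ^ 2 *
        gaussKernel d σ y x - (1 / 2 : ℝ) * ‖(σ ^ 2)⁻¹ • (x - y)‖ ^ 2 * gaussKernel d σ y x) P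
    · rw [← integral_neg, ← integral_const_mul]
      refine integral_mono hi.neg
        ((integrable_norm_sq_mul_gaussKernel_right hσ y).const_mul _) fun x => ?_
      have := mul_nonneg (sq_nonneg ‖score d σ P y - (σ ^ 2)⁻¹ • (x - y)‖)
        (gaussKernel_pos d hσ y x).le
      dsimp only
      linarith
    · rw [integral_undef hi, neg_zero]
      exact mul_nonneg (by norm_num) (integral_nonneg fun x =>
        mul_nonneg (sq_nonneg _) (gaussKernel_pos d hσ y x).le)
  simp only [sub_self, norm_zero] at h
  linarith

lemma integrable_norm_score_sq_mul_smoothedDensity (hσ : 0 < σ) :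
    Integrable fun y => (1 / 2 : ℝ) * ‖score d σ P y‖ ^ 2 * smoothedDensity d σ P y := by
  refine (integrable_norm_sq_mul_gaussKernel_prod (P := P) hσ).integral_prod_left.mono' ?_
    (.of_forall fun y => ?_)
  · have h1 := measurable_score (P := P) hσ
    have h2 := measurable_smoothedDensity (σ := σ) (P := P)
    exact Measurable.aestronglyMeasurable (by fun_prop)
  · have hQ := smoothedDensity_pos (P := P) hσ y
    rw [Real.norm_of_nonneg (by positivity)]
    refine le_trans ?_ (norm_score_sq_mul_smoothedDensity_le hσ y)
    nlinarith [mul_nonneg (sq_nonneg ‖score d σ P y‖) hQ.le]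

end Score


/-- The direct and denoising score-matching objectives differ by a constant
independent of `g`, and all four integrals are finite. -/
theorem score_matching_objectives_differ_by_constant
    (d : ℕ) (hd : 1 ≤ d)
    (P : Measure (EuclideanSpace ℝ (Fin d))) [IsProbabilityMeasure P]
    (hP : ∃ K : Set (EuclideanSpace ℝ (Fin d)), IsCompact K ∧ P Kᶜ = 0)
    (σ : ℝ) (hσ : 0 < σ)
    (g : EuclideanSpace ℝ (Fin d) → EuclideanSpace ℝ (Fin d))
    (hg : Measurable g) (hgb : ∃ C : ℝ, ∀ y, ‖g y‖ ≤ C) :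
    Integrable (fun y => (1 / 2 : ℝ) * ‖g y - score d σ P y‖ ^ 2 * smoothedDensity d σ P y) ∧
    Integrable (fun x => ∫ y, (1 / 2 : ℝ) * ‖g y - (σ ^ 2)⁻¹ • (x - y)‖ ^ 2 * gaussKernel d σ y x) P ∧
    Integrable (fun y => (1 / 2 : ℝ) * ‖score d σ P y‖ ^ 2 * smoothedDensity d σ P y) ∧
    Integrable (fun x => ∫ y, (1 / 2 : ℝ) * ‖(σ ^ 2)⁻¹ • (x - y)‖ ^ 2 * gaussKernel d σ y x) P ∧
    (∫ y, (1 / 2 : ℝ) * ‖g y - score d σ P y‖ ^ 2 * smoothedDensity d σ P y)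
        - (∫ x, (∫ y, (1 / 2 : ℝ) * ‖g y - (σ ^ 2)⁻¹ • (x - y)‖ ^ 2 * gaussKernel d σ y x) ∂P)
      = (∫ y, (1 / 2 : ℝ) * ‖score d σ P y‖ ^ 2 * smoothedDensity d σ P y)
        - (∫ x, (∫ y, (1 / 2 : ℝ) * ‖(σ ^ 2)⁻¹ • (x - y)‖ ^ 2 * gaussKernel d σ y x) ∂P) := by
  obtain ⟨C, hC⟩ := hgb
  have hJ := integrable_norm_sub_sq_mul_gaussKernel_prod (P := P) hσ hg hC
  have hV := ((integrable_norm_sq_mul_gaussKernel_prod (P := P) hσ).const_mul (1 / 2 : ℝ))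
  simp only [← mul_assoc] at hV
  have hS := integrable_norm_score_sq_mul_smoothedDensity (P := P) hσ
  have hJV := hJ.sub hV
  have hA := hJV.integral_prod_left
  simp only [Pi.sub_apply, integral_norm_sub_sq_sub_norm_sq hσ] at hA
  have hD : Integrable fun y =>
      (1 / 2 : ℝ) * ‖g y - score d σ P y‖ ^ 2 * smoothedDensity d σ P y := by
    refine (hA.add hS).congr (.of_forall fun y => ?_)
    simp only [Pi.add_apply, sub_add_cancel]
  refine ⟨hD, hJ.integral_prod_right, hS, hV.integral_prod_right, ?_⟩
  have hprod := integral_sub' hJ hV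
  rw [integral_prod _ hJV, integral_prod_symm _ hJ, integral_prod_symm _ hV] at hprod
  simp only [Pi.sub_apply, integral_norm_sub_sq_sub_norm_sq hσ] at hprod
  rw [integral_sub hD hS] at hprod
  linarith
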